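/- arXiv:2603.27730 — 3 statements merged into one kernel-verified Lean document; each statement's English description precedes it below -/
import Mathlib

section
/- Let T be a finite abelian group and let R be a commutative ring that is elementarily equivalent to ℤ in the first-order language of rings. Then there is an isomorphism of abelian groups (ℤ-modules) R ⊗[ℤ] T ≅ T. -/
open FirstOrder Language TensorProduct

noncomputable instance : FirstOrder.Ring.CompatibleRing ℤ :=
  FirstOrder.Ring.compatibleRingOfRing ℤ

/-- The sentence of the language of rings saying that `n` divides `k`. -/
noncomputable def natDvdSentence (n k : ℕ) : Language.ring.Sentence :=
  BoundedFormula.ex (Term.bdEqual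
    (((Ring.termOfFreeCommRing (n : FreeCommRing (Empty ⊕ Fin 1))) * Term.var (Sum.inr 0) :
      Language.ring.Term (Empty ⊕ Fin 1)))
    (Ring.termOfFreeCommRing (k : FreeCommRing (Empty ⊕ Fin 1))))

/-- The sentence of the language of rings saying that every element is congruent modulo `n` to
one of `0, …, n - 1`. -/
noncomputable def natRemainderSentence (n : ℕ) : Language.ring.Sentence :=
  BoundedFormula.all (BoundedFormula.ex (BoundedFormula.iSup fun k : Fin n => Term.bdEqual
    (Term.var (Sum.inr 0) : Language.ring.Term (Empty ⊕ Fin 2))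
    ((Ring.termOfFreeCommRing (n : FreeCommRing (Empty ⊕ Fin 2))) * Term.var (Sum.inr 1) +
      Ring.termOfFreeCommRing ((k : ℕ) : FreeCommRing (Empty ⊕ Fin 2)))))

section Realize

variable {R : Type*} [CommRing R] [FirstOrder.Ring.CompatibleRing R]

theorem realize_natDvdSentence (n k : ℕ) :
    R ⊨ natDvdSentence n k ↔ (n : R) ∣ (k : R) := by
  simp [natDvdSentence, Sentence.Realize, Formula.Realize, Fin.snoc, Dvd.dvd, eq_comm]

theorem realize_natRemainderSentence (n : ℕ) :
    R ⊨ natRemainderSentence n ↔ ∀ x : R, ∃ y : R, ∃ k : Fin n, x = n * y + (k : ℕ) := by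
  simp [natRemainderSentence, Sentence.Realize, Formula.Realize, Fin.snoc]

end Realize

/-- If `R` has a ring homomorphism to `ZMod n` and every element of `R` is congruent modulo `n` to
a natural number, then tensoring with `R` does not change abelian groups killed by `n`. -/
theorem nonempty_tensorProduct_linearEquiv_of_nsmul_eq_zero {R T : Type*} [CommRing R]
    [AddCommGroup T] {n : ℕ} (hT : ∀ t : T, n • t = 0) (f : R →+* ZMod n)
    (hR : ∀ x : R, ∃ (y : R) (k : ℕ), x = n * y + k) :
    Nonempty ((R ⊗[ℤ] T) ≃ₗ[ℤ] T) := by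
  let _ : Module (ZMod n) T := AddCommGroup.zmodModule hT
  let g : R ⊗[ℤ] T →ₗ[ℤ] T := TensorProduct.lift
    (LinearMap.mk₂ ℤ (fun r t => f r • t) (fun a b t => by simp [add_smul])
      (fun c a t => by simp [mul_smul, Int.cast_smul_eq_zsmul])
      (fun a s t => smul_add _ _ _)
      (fun c a t => smul_comm _ _ _))
  have hkill (y : R) (t : T) : ((n : R) * y) ⊗ₜ[ℤ] t = 0 := by
    rw [← nsmul_eq_mul, ← natCast_zsmul, TensorProduct.smul_tmul, natCast_zsmul, hT,
      TensorProduct.tmul_zero]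
  have hnat (k : ℕ) (t : T) : (k : R) ⊗ₜ[ℤ] t = 1 ⊗ₜ[ℤ] (k • t) := by
    rw [← nsmul_one, ← natCast_zsmul, TensorProduct.smul_tmul, natCast_zsmul]
  refine ⟨LinearEquiv.ofLinearMap g (TensorProduct.mk ℤ R T 1) ?_ ?_⟩
  · ext t
    change f 1 • t = t
    rw [map_one, one_smul]
  · refine TensorProduct.ext' fun r t => ?_
    obtain ⟨y, k, rfl⟩ := hR r
    change 1 ⊗ₜ[ℤ] (f (n * y + k) • t) = (n * y + k) ⊗ₜ[ℤ] t
    rw [TensorProduct.add_tmul, hkill, hnat, zero_add, map_add, map_mul, map_natCast, map_natCast,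
      CharP.cast_eq_zero, zero_mul, zero_add, Nat.cast_smul_eq_nsmul]

/-- If `n` divides exactly the expected natural numbers in `R`, and every element of `R` is
congruent modulo `n` to a natural number, then `R` maps to `ZMod n`. -/
theorem nonempty_ringHom_zmod {R : Type*} [CommRing R] {n : ℕ}
    (hdvd : ∀ k : ℕ, (n : R) ∣ k ↔ n ∣ k)
    (hR : ∀ x : R, ∃ (y : R) (k : ℕ), x = n * y + k) :
    Nonempty (R →+* ZMod n) := by
  let I : Ideal R := Ideal.span {(n : R)}
  have : CharP (R ⧸ I) n := ⟨fun k => by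
    rw [← map_natCast (Ideal.Quotient.mk I), Ideal.Quotient.eq_zero_iff_mem,
      Ideal.mem_span_singleton, hdvd]⟩
  have hbij : Function.Bijective (ZMod.castHom (dvd_refl n) (R ⧸ I)) := by
    refine ⟨ZMod.castHom_injective _, fun x => ?_⟩
    obtain ⟨x, rfl⟩ := Ideal.Quotient.mk_surjective x
    obtain ⟨y, k, rfl⟩ := hR x
    refine ⟨k, ?_⟩
    rw [map_natCast, map_add, map_natCast, right_eq_add, Ideal.Quotient.eq_zero_iff_mem]
    exact Ideal.mul_mem_right _ _ (Ideal.mem_span_singleton_self _)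
  exact ⟨(RingEquiv.ofBijective _ hbij).symm.toRingHom.comp (Ideal.Quotient.mk I)⟩

theorem Int.exists_eq_natCast_mul_add_fin {n : ℕ} (hn : 0 < n) (x : ℤ) :
    ∃ y : ℤ, ∃ k : Fin n, x = n * y + (k : ℕ) := by
  have h0 : 0 ≤ x % n := Int.emod_nonneg _ (by lia)
  have h1 : x % n < n := Int.emod_lt_of_pos _ (by lia)
  refine ⟨x / n, ⟨(x % n).toNat, by lia⟩, ?_⟩
  rw [Int.toNat_of_nonneg h0, Int.mul_ediv_add_emod]

theorem stmt_4 (T : Type*) [AddCommGroup T] [Finite T]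
    (R : Type*) [CommRing R] [FirstOrder.Ring.CompatibleRing R]
    (h : R ≅[Language.ring] ℤ) :
    Nonempty ((R ⊗[ℤ] T) ≃ₗ[ℤ] T) := by
  have key := elementarilyEquivalent_iff.mp h
  have hdvd (k : ℕ) : (Nat.card T : R) ∣ k ↔ Nat.card T ∣ k := by
    rw [← realize_natDvdSentence, key, realize_natDvdSentence, Int.natCast_dvd_natCast]
  have hR (x : R) : ∃ (y : R) (k : ℕ), x = (Nat.card T : R) * y + k := by
    obtain ⟨y, k, hk⟩ := (realize_natRemainderSentence _).mp ((key _).mpr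
      ((realize_natRemainderSentence _).mpr (Int.exists_eq_natCast_mul_add_fin
        (Nat.card_pos (α := T))))) x
    exact ⟨y, k, hk⟩
  obtain ⟨f⟩ := nonempty_ringHom_zmod hdvd hR
  exact nonempty_tensorProduct_linearEquiv_of_nsmul_eq_zero (fun _ => card_nsmul_eq_zero') f hR
end

section
/- Let A be a ring (an abelian group with a ℤ-bilinear multiplication, not necessarily associative, commutative, or unital) whose additive group is finitely generated, let I be a set, let u be an ultrafilter on I, and let f : I → A. Then the germ of f lies in Is((A*)²) = {x ∈ A* | n•x ∈ (A*)² for some integer n ≥ 1}, where A* = Filter.Germ (↑u) A and (A*)² is the additive subgroup of A* generated by all products, if and only if the set {i ∈ I | f(i) ∈ Is(A²)} belongs to u. -/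
open Filter

/-- `A²`: the additive subgroup of a (not necessarily associative/unital) ring `A`
generated by all products `x * y`. -/
def sqSubgroup (A : Type*) [NonUnitalNonAssocRing A] : AddSubgroup A :=
  AddSubgroup.closure {z : A | ∃ x y : A, z = x * y}

/-- The isolator `Is(J) = {x | n•x ∈ J for some integer n ≥ 1}` of an additive
subgroup `J`, as a set. -/
def isolator {A : Type*} [NonUnitalNonAssocRing A] (J : AddSubgroup A) : Set A :=
  {x : A | ∃ n : ℤ, 1 ≤ n ∧ n • x ∈ J}

/-- If the ambient additive group is finitely generated, then `Is(J) / J` has finite exponent. -/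
theorem exists_nsmul_mem_of_mem_isolator {A : Type*} [NonUnitalNonAssocRing A] [Module.Finite ℤ A]
    (J : AddSubgroup A) : ∃ N : ℕ, 0 < N ∧ ∀ x ∈ isolator J, N • x ∈ J := by
  let F : ℕ →o Submodule ℤ A :=
    { toFun := fun m => (AddSubgroup.toIntSubmodule J).comap
        (LinearMap.lsmul ℤ A (m.factorial : ℤ))
      monotone' := by
        intro m n hmn x hx
        obtain ⟨c, hc⟩ := Nat.factorial_dvd_factorial hmn
        change ((n.factorial : ℤ)) • x ∈ J
        change ((m.factorial : ℤ)) • x ∈ J at hx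
        rw [hc, mul_comm, Nat.cast_mul, mul_smul]
        exact J.zsmul_mem hx _ }
  obtain ⟨N, hN⟩ := monotone_stabilizes_iff_noetherian.mpr (inferInstance : IsNoetherian ℤ A) F
  refine ⟨N.factorial, N.factorial_pos, ?_⟩
  rintro x ⟨n, hn, hx⟩
  lift n to ℕ using by lia
  have hxn : x ∈ F n := by
    obtain ⟨c, hc⟩ := Nat.dvd_factorial (show 0 < n by lia) le_rfl
    change ((n.factorial : ℤ)) • x ∈ J
    rw [hc, mul_comm, Nat.cast_mul, mul_smul]
    exact J.zsmul_mem hx _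
  have hxN : x ∈ F N := by
    rcases le_total n N with h | h
    · exact F.monotone h hxn
    · rwa [hN n h]
  change ((N.factorial : ℤ)) • x ∈ J at hxN
  rwa [natCast_zsmul] at hxN

/-- In a finitely generated ring, every element of `A²` is a sum of products whose left factors
run over a fixed finite set. -/
theorem exists_finset_forall_mem_sqSubgroup (A : Type*) [NonUnitalNonAssocRing A]
    [Module.Finite ℤ A] :
    ∃ s : Finset A, ∀ z ∈ sqSubgroup A, ∃ y : A → A, z = ∑ a ∈ s, a * y a := by
  obtain ⟨s, hs⟩ := (Module.Finite.fg_top : (⊤ : Submodule ℤ A).FG)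
  refine ⟨s, fun z hz => ?_⟩
  induction hz using AddSubgroup.closure_induction with
  | mem z hz =>
    obtain ⟨x, y, rfl⟩ := hz
    have hx : x ∈ Submodule.span ℤ (s : Set A) := hs ▸ Submodule.mem_top
    obtain ⟨c, -, rfl⟩ := Submodule.mem_span_finset.mp hx
    exact ⟨fun a => c a • y, by simp only [Finset.sum_mul, smul_mul_assoc, mul_smul_comm]⟩
  | zero => exact ⟨0, by simp⟩
  | add x y _ _ hx hy =>
    obtain ⟨v, rfl⟩ := hx
    obtain ⟨w, rfl⟩ := hy
    exact ⟨v + w, by simp [mul_add, Finset.sum_add_distrib]⟩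
  | neg x _ hx =>
    obtain ⟨v, rfl⟩ := hx
    exact ⟨-v, by simp⟩

theorem eventually_mem_sqSubgroup_of_coe_mem {A I : Type*} [NonUnitalNonAssocRing A]
    {l : Filter I} {f : I → A} (hf : (↑f : Germ l A) ∈ sqSubgroup (Germ l A)) :
    ∀ᶠ i in l, f i ∈ sqSubgroup A := by
  suffices h : ∀ x ∈ sqSubgroup (Germ l A), x.LiftPred (· ∈ sqSubgroup A) from h _ hf
  intro x hx
  induction hx using AddSubgroup.closure_induction with
  | mem z hz =>
    obtain ⟨x, y, rfl⟩ := hz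
    induction x, y using Germ.inductionOn₂ with
    | _ x y =>
      exact Eventually.of_forall fun i => AddSubgroup.subset_closure ⟨x i, y i, rfl⟩
  | zero => exact Eventually.of_forall fun _ => zero_mem _
  | add x y _ _ hx hy =>
    induction x, y using Germ.inductionOn₂ with
    | _ x y =>
      rw [Germ.liftPred_coe] at hx hy
      exact (hx.and hy).mono fun i hi => add_mem hi.1 hi.2
  | neg x _ hx =>
    induction x using Germ.inductionOn with
    | _ x => exact Eventually.mono hx fun i hi => neg_mem hi

theorem coe_mem_sqSubgroup_of_eventually_mem {A I : Type*} [NonUnitalNonAssocRing A]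
    [Module.Finite ℤ A] {l : Filter I} {f : I → A} (hf : ∀ᶠ i in l, f i ∈ sqSubgroup A) :
    (↑f : Germ l A) ∈ sqSubgroup (Germ l A) := by
  obtain ⟨s, hs⟩ := exists_finset_forall_mem_sqSubgroup A
  choose! y hy using hs
  have hfy : (↑f : Germ l A) = ↑(∑ a ∈ s, fun i => a * y (f i) a) :=
    Germ.coe_eq.mpr (hf.mono fun i hi => by simpa using hy _ hi)
  have hsum := map_sum (Germ.coeAddHom l : (I → A) →+ Germ l A) (fun a i => a * y (f i) a) s
  simp only [Germ.coe_coeAddHom] at hsum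
  rw [hfy, hsum]
  exact sum_mem fun a _ => AddSubgroup.subset_closure ⟨↑a, ↑fun i => y (f i) a, rfl⟩

theorem stmt_12 (A : Type*) [NonUnitalNonAssocRing A] [Module.Finite ℤ A]
    (I : Type*) (u : Ultrafilter I) (f : I → A) :
    (↑f : Germ (↑u : Filter I) A) ∈ isolator (sqSubgroup (Germ (↑u : Filter I) A)) ↔
      {i : I | f i ∈ isolator (sqSubgroup A)} ∈ u := by
  constructor
  · rintro ⟨n, hn, h⟩
    exact (eventually_mem_sqSubgroup_of_coe_mem (f := n • f) h).mono fun i hi => ⟨n, hn, hi⟩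
  · intro h
    obtain ⟨N, hN, hJ⟩ := exists_nsmul_mem_of_mem_isolator (sqSubgroup A)
    have h' : ∀ᶠ i in (u : Filter I), ((N : ℤ) • f) i ∈ sqSubgroup A :=
      Eventually.mono h fun i hi => by simpa using hJ _ hi
    exact ⟨N, by exact_mod_cast hN, coe_mem_sqSubgroup_of_eventually_mem h'⟩
end

section
/- Let A be a ring (an abelian group with a ℤ-bilinear multiplication, not necessarily associative, commutative, or unital) whose additive group is finitely generated. Assume that Ann(A) is infinite, that Ann(A) ⊆ Δ(A), and that Δ(A) ≠ A. Let u be a nonprincipal ultrafilter on ℕ and let A* = Filter.Germ (↑u) A and ℤ* = Filter.Germ (↑u) ℤ. Then there exist an element a ∈ A of infinite additive order with a ∉ Δ(A), and a ring automorphism σ of A* that fixes every element of the diagonal copy of A, such that σ does not map the set Z* = { t • (diagonal image of a) | t ∈ ℤ* } into itself; in particular σ is not the identity. -/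
open Filter

/-- The two-sided annihilator of a (not necessarily associative/unital) ring,
as a set. -/
def annSet (A : Type*) [NonUnitalNonAssocRing A] : Set A :=
  {x : A | ∀ y : A, x * y = 0 ∧ y * x = 0}

/-- `Δ(A) = Is(A²)`: the isolator of the additive subgroup generated by all
products `x * y`, as a set. -/
def deltaSet (A : Type*) [NonUnitalNonAssocRing A] : Set A :=
  {x : A | ∃ n : ℤ, 1 ≤ n ∧
    n • x ∈ AddSubgroup.closure {z : A | ∃ u v : A, z = u * v}}

/-- The additive homomorphism induced on germs by an additive homomorphism. -/
def Filter.Germ.mapAddHom {ι M N : Type*} (l : Filter ι) [AddMonoid M] [AddMonoid N]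
    (φ : M →+ N) : Germ l M →+ Germ l N where
  toFun := Germ.map φ
  map_zero' := congrArg (fun g : ι → N => (g : Germ l N)) (funext fun _ => φ.map_zero)
  map_add' x y := by
    induction x using Germ.inductionOn with | _ g =>
    induction y using Germ.inductionOn with | _ h =>
    exact congrArg (fun g : ι → N => (g : Germ l N)) (funext fun _ => φ.map_add _ _)

theorem Filter.Germ.mapAddHom_injective {ι M N : Type*} (l : Filter ι) [AddMonoid M] [AddMonoid N]
    {φ : M →+ N} (hφ : Function.Injective φ) : Function.Injective (Germ.mapAddHom l φ) := by
  intro x y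
  induction x using Germ.inductionOn with | _ g =>
  induction y using Germ.inductionOn with | _ h =>
  intro hxy
  exact Germ.coe_eq.2 ((Germ.coe_eq.1 hxy).mono fun i hi => hφ hi)

/-- An element of a finitely generated abelian group having no nonzero multiple in a subgroup `B`
is detected by an integer-valued functional vanishing on `B`. -/
theorem exists_addMonoidHom_int_apply_ne_zero {M : Type*} [AddCommGroup M] [Module.Finite ℤ M]
    (B : AddSubgroup M) {x : M} (hx : ∀ n : ℤ, 1 ≤ n → n • x ∉ B) :
    ∃ f : M →+ ℤ, f x ≠ 0 ∧ ∀ y ∈ B, f y = 0 := by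
  let B' : Submodule ℤ M := AddSubgroup.toIntSubmodule B
  let T := Submodule.torsion ℤ (M ⧸ B')
  have hxT : T.mkQ (B'.mkQ x) ≠ 0 := by
    intro h
    rw [Submodule.mkQ_apply, Submodule.Quotient.mk_eq_zero] at h
    obtain ⟨⟨n, hn⟩, h⟩ := (Submodule.mem_torsion_iff _).1 h
    have hn0 : n ≠ 0 := nonZeroDivisors.ne_zero hn
    have h' : n • x ∈ B := by
      have : B'.mkQ (n • x) = 0 := by rw [map_smul]; exact h
      exact (Submodule.Quotient.mk_eq_zero B').1 this
    rcases abs_choice n with habs | habs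
    · refine hx |n| (Int.one_le_abs hn0) ?_
      rwa [habs]
    · refine hx |n| (Int.one_le_abs hn0) ?_
      rw [habs, neg_smul]
      exact B.neg_mem h'
  obtain ⟨g, hg⟩ : ∃ g : Module.Dual ℤ ((M ⧸ B') ⧸ T), g (T.mkQ (B'.mkQ x)) ≠ 0 := by
    by_contra! h
    exact hxT ((Module.forall_dual_apply_eq_zero_iff ℤ _).1 h)
  refine ⟨(g ∘ₗ T.mkQ ∘ₗ B'.mkQ).toAddMonoidHom, hg, fun y hy => ?_⟩
  have : B'.mkQ y = 0 := (Submodule.Quotient.mk_eq_zero B').2 hy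
  simp [this]

/-- An infinite subgroup of a finitely generated abelian group has an element of infinite order. -/
theorem AddSubgroup.exists_zsmul_ne_zero_of_infinite {M : Type*} [AddCommGroup M]
    [Module.Finite ℤ M] (B : AddSubgroup M) (hB : (B : Set M).Infinite) :
    ∃ c ∈ B, ∀ n : ℤ, n ≠ 0 → n • c ≠ 0 := by
  by_contra! h
  let B' : Submodule ℤ M := AddSubgroup.toIntSubmodule B
  have htor : Module.IsTorsion ℤ B' := by
    rintro ⟨c, hc⟩
    obtain ⟨n, hn, hnc⟩ := h c hc
    exact ⟨⟨n, mem_nonZeroDivisors_of_ne_zero hn⟩, Subtype.ext hnc⟩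
  have : Finite B' := Module.finite_of_fg_torsion B' htor
  exact hB (Set.toFinite (B' : Set M))

/-- The shear `x ↦ x + δ x` along an additive endomorphism of square zero which kills products and
takes values in the annihilator. -/
def RingEquiv.shear {R : Type*} [NonUnitalNonAssocRing R] (δ : R →+ R)
    (hδ : ∀ x, δ (δ x) = 0) (hmul : ∀ x y, δ (x * y) = 0)
    (hann : ∀ x y, δ x * y = 0 ∧ y * δ x = 0) : R ≃+* R where
  toFun x := x + δ x
  invFun x := x - δ x
  left_inv x := by simp [hδ]
  right_inv x := by simp [hδ]
  map_mul' x y := by simp [hmul, add_mul, mul_add, (hann _ _).1, (hann _ _).2]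
  map_add' x y := by rw [map_add]; abel

theorem Rat.exists_int_eq_mul_factorial (q : ℚ) {n : ℕ} (hn : q.den ≤ n) :
    ∃ k : ℤ, (k : ℚ) = q * n.factorial := by
  obtain ⟨m, hm⟩ := Nat.dvd_factorial q.den_pos hn
  refine ⟨q.num * m, ?_⟩
  rw [hm]
  push_cast
  rw [← mul_assoc, Rat.mul_den_eq_num]

/-- The additive embedding of `ℚ` into an ultrapower of `ℤ` sending `q` to the class of
`n ↦ q * n!`. -/
noncomputable def ratToGermInt (l : Filter ℕ) (hl : l ≤ cofinite) : ℚ →+ Germ l ℤ where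
  toFun q := ((fun n : ℕ => ⌊q * n.factorial⌋ : ℕ → ℤ) : Germ l ℤ)
  map_zero' := congrArg (fun g : ℕ → ℤ => (g : Germ l ℤ)) (funext fun _ => by simp)
  map_add' p q := by
    refine Germ.coe_eq.2 ?_
    rw [Nat.cofinite_eq_atTop] at hl
    filter_upwards [hl (eventually_ge_atTop p.den)] with n hp
    obtain ⟨k, hk⟩ := p.exists_int_eq_mul_factorial hp
    simp [add_mul, ← hk]

theorem ratToGermInt_injective (l : Filter ℕ) [l.NeBot] (hl : l ≤ cofinite) :
    Function.Injective (ratToGermInt l hl) := by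
  rw [injective_iff_map_eq_zero]
  intro q hq
  have h0 : ∀ᶠ n : ℕ in l, ⌊q * n.factorial⌋ = 0 := Germ.coe_eq.1 hq
  rw [Nat.cofinite_eq_atTop] at hl
  obtain ⟨n, hn, hqn⟩ := (h0.and (hl (eventually_ge_atTop q.den))).exists
  obtain ⟨k, hk⟩ := q.exists_int_eq_mul_factorial hqn
  rw [← hk, Int.floor_intCast] at hn
  rw [hn, Int.cast_zero] at hk
  exact (mul_eq_zero.1 hk.symm).resolve_right (by exact_mod_cast n.factorial_ne_zero)

/-- A nonprincipal ultrapower of `ℤ` has a nonzero additive endomorphism killing the diagonal. -/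
theorem exists_germ_int_endomorphism (l : Filter ℕ) [l.NeBot] (hl : l ≤ cofinite) :
    ∃ φ : Germ l ℤ →+ Germ l ℤ, (∀ k : ℤ, φ (↑k : Germ l ℤ) = 0) ∧ ∃ t, φ t ≠ 0 := by
  let d : Germ l ℚ := ((fun n : ℕ => (n : ℚ) : ℕ → ℚ) : Germ l ℚ)
  let e : Germ l ℚ := (↑(1 : ℚ) : Germ l ℚ)
  have hd : d ∉ Submodule.span ℚ {e} := by
    intro h
    obtain ⟨q, hq⟩ := Submodule.mem_span_singleton.1 h
    have hq' : ∀ᶠ n : ℕ in l, q • (1 : ℚ) = (n : ℚ) := Germ.coe_eq.1 hq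
    have hfin : {n : ℕ | ¬ q • (1 : ℚ) ≠ (n : ℚ)}.Finite := by
      refine Set.Subsingleton.finite fun m hm n hn => ?_
      have hmn : (m : ℚ) = n := (not_not.1 hm).symm.trans (not_not.1 hn)
      exact_mod_cast hmn
    obtain ⟨n, h₁, h₂⟩ := (hq'.and (hl hfin)).exists
    exact h₂ h₁
  obtain ⟨ψ, hψd, hψ⟩ := Submodule.exists_le_ker_of_notMem hd
  let cast := Germ.mapAddHom l (Int.castAddHom ℚ)
  refine ⟨(ratToGermInt l hl).comp (ψ.toAddMonoidHom.comp cast), fun k => ?_,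
    ((fun n : ℕ => (n : ℤ) : ℕ → ℤ) : Germ l ℤ), ?_⟩
  · have hk : cast (↑k : Germ l ℤ) = (k : ℚ) • e :=
      congrArg (fun g : ℕ → ℚ => (g : Germ l ℚ)) (funext fun _ => by simp)
    have he : ψ e = 0 := hψ (Submodule.mem_span_singleton_self e)
    simp [hk, he]
  · have ht : cast ((fun n : ℕ => (n : ℤ) : ℕ → ℤ) : Germ l ℤ) = d :=
      congrArg (fun g : ℕ → ℚ => (g : Germ l ℚ)) (funext fun _ => by simp)
    intro h
    refine hψd (ratToGermInt_injective l hl ?_)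
    rw [map_zero, ← h, ← ht]
    rfl

theorem stmt_16 (A : Type*) [NonUnitalNonAssocRing A] [Module.Finite ℤ A]
    (hinf : (annSet A).Infinite) (hsub : annSet A ⊆ deltaSet A)
    (hne : deltaSet A ≠ Set.univ)
    (u : Ultrafilter ℕ) (hu : (↑u : Filter ℕ) ≤ Filter.cofinite) :
    ∃ a : A, (∀ n : ℤ, n ≠ 0 → n • a ≠ 0) ∧ a ∉ deltaSet A ∧
      ∃ σ : Germ (↑u : Filter ℕ) A ≃+* Germ (↑u : Filter ℕ) A,
        (∀ x : A, σ (↑x : Germ (↑u : Filter ℕ) A) = (↑x : Germ (↑u : Filter ℕ) A)) ∧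
        ¬ (∀ x ∈ {x : Germ (↑u : Filter ℕ) A | ∃ t : Germ (↑u : Filter ℕ) ℤ,
              x = t • (↑a : Germ (↑u : Filter ℕ) A)},
            σ x ∈ {x : Germ (↑u : Filter ℕ) A | ∃ t : Germ (↑u : Filter ℕ) ℤ,
              x = t • (↑a : Germ (↑u : Filter ℕ) A)}) ∧
        σ ≠ RingEquiv.refl (Germ (↑u : Filter ℕ) A) := by
  let l : Filter ℕ := ↑u
  let B : AddSubgroup A := AddSubgroup.closure {z : A | ∃ u v : A, z = u * v}
  obtain ⟨a, ha⟩ := (Set.ne_univ_iff_exists_notMem _).1 hne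
  obtain ⟨f, hfa, hfB⟩ := exists_addMonoidHom_int_apply_ne_zero B (x := a)
    fun n hn h => ha ⟨n, hn, h⟩
  let Z : AddSubgroup A :=
    { carrier := annSet A
      zero_mem' := fun y => by simp
      add_mem' := fun {x z} hx hz y => by
        simp [add_mul, mul_add, (hx y).1, (hx y).2, (hz y).1, (hz y).2]
      neg_mem' := fun {x} hx y => by simp [(hx y).1, (hx y).2] }
  obtain ⟨c, hcZ, hc⟩ := Z.exists_zsmul_ne_zero_of_infinite hinf
  have hfc : f c = 0 := by
    obtain ⟨n, hn, hnc⟩ := hsub hcZ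
    have h := hfB _ hnc
    rw [map_zsmul, smul_eq_mul] at h
    exact (mul_eq_zero.1 h).resolve_left (by lia)
  obtain ⟨φ, hφ, t, ht⟩ := exists_germ_int_endomorphism l hu
  let F : Germ l A →+ Germ l ℤ := Germ.mapAddHom l f
  let C : Germ l ℤ →+ Germ l A := Germ.mapAddHom l (zmultiplesHom A c)
  have hC : Function.Injective C := by
    refine Germ.mapAddHom_injective l ((injective_iff_map_eq_zero _).2 fun n hn => ?_)
    by_contra hn0
    exact hc n hn0 hn
  have hFC : ∀ s, F (C s) = 0 := by
    intro s
    induction s using Germ.inductionOn with | _ g =>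
    exact congrArg (fun g : ℕ → ℤ => (g : Germ l ℤ)) (funext fun _ => by simp [hfc])
  have hFmul : ∀ x y, F (x * y) = 0 := by
    intro x y
    induction x using Germ.inductionOn with | _ g =>
    induction y using Germ.inductionOn with | _ h =>
    exact congrArg (fun g : ℕ → ℤ => (g : Germ l ℤ))
      (funext fun _ => hfB _ (AddSubgroup.subset_closure ⟨_, _, rfl⟩))
  have hCann : ∀ s y, C s * y = 0 ∧ y * C s = 0 := by
    intro s y
    induction s using Germ.inductionOn with | _ g =>
    induction y using Germ.inductionOn with | _ h =>
    have hgn := fun n => Z.zsmul_mem hcZ (g n) (h n)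
    exact ⟨congrArg (fun g : ℕ → A => (g : Germ l A)) (funext fun n => (hgn n).1),
      congrArg (fun g : ℕ → A => (g : Germ l A)) (funext fun n => (hgn n).2)⟩
  have hFsmul : ∀ s : Germ l ℤ, F (s • (↑a : Germ l A)) = f a • s := by
    intro s
    induction s using Germ.inductionOn with | _ g =>
    exact congrArg (fun g : ℕ → ℤ => (g : Germ l ℤ)) (funext fun _ => by simp [mul_comm])
  have hsmul : Function.Injective fun s : Germ l ℤ => f a • s := by
    intro r s
    induction r using Germ.inductionOn with | _ g =>
    induction s using Germ.inductionOn with | _ h =>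
    intro hgh
    exact Germ.coe_eq.2 ((Germ.coe_eq.1 hgh).mono fun i hi => mul_left_cancel₀ hfa hi)
  let δ : Germ l A →+ Germ l A := C.comp (φ.comp F)
  let σ := RingEquiv.shear δ (fun x => by simp [δ, hFC]) (fun x y => by simp [δ, hFmul])
    (fun x y => hCann _ y)
  have hmove : ∀ s : Germ l ℤ, σ (t • (↑a : Germ l A)) ≠ s • (↑a : Germ l A) := by
    intro s hs
    have hs' : t • (↑a : Germ l A) + C (φ (F (t • (↑a : Germ l A)))) = s • (↑a : Germ l A) := hs
    have hts : t = s := by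
      have := congrArg F hs'
      rw [map_add, hFC, add_zero, hFsmul, hFsmul] at this
      exact hsmul this
    rw [← hts, add_eq_left, map_eq_zero_iff C hC, hFsmul, map_zsmul] at hs'
    exact ht (hsmul (hs'.trans (smul_zero (f a)).symm))
  refine ⟨a, fun n hn h => ?_, ha, σ, fun x => ?_, fun h => ?_, fun h => ?_⟩
  · have := congrArg f h
    rw [map_zsmul, map_zero, smul_eq_mul] at this
    exact (mul_ne_zero hn hfa) this
  · have hδ : δ (↑x : Germ l A) = 0 := by
      change C (φ (↑(f x) : Germ l ℤ)) = 0
      rw [hφ, map_zero]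
    change (↑x : Germ l A) + δ (↑x : Germ l A) = ↑x
    rw [hδ, add_zero]
  · obtain ⟨s, hs⟩ := h _ ⟨t, rfl⟩
    exact hmove s hs
  · exact hmove t (by rw [h]; rfl)
end
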